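/- For every positive integer n, every element (a,b) of an optimal set of n-points for P satisfies −1/(2n) ≤ a ≤ (n−1)/(2n); equivalently, all elements of an optimal set of n-points lie on S_n between the points (−1/(2n), 1/(2n)) and ((n−1)/(2n), (n+1)/(2n)). -/

import Mathlib

open MeasureTheory

noncomputable section

/-- The Euclidean plane ℝ². -/
abbrev Plane : Type := EuclideanSpace ℝ (Fin 2)

/-- The point (x, y) in the Euclidean plane. -/
def pt (x y : ℝ) : Plane := (WithLp.equiv 2 (Fin 2 → ℝ)).symm ![x, y]

/-- P: the uniform probability measure on the segment J = [0,1] × {0}, i.e. the pushforward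
of Lebesgue measure restricted to [0,1] under x ↦ (x, 0). -/
def P : Measure Plane :=
  Measure.map (fun x : ℝ => pt x 0) (volume.restrict (Set.Icc (0 : ℝ) 1))

/-- The constraint S_j = {(x, x + 1/j) : -1/j ≤ x ≤ 1}. -/
def S (j : ℕ) : Set Plane :=
  {p | ∃ x : ℝ, -(1 / (j : ℝ)) ≤ x ∧ x ≤ 1 ∧ p = pt x (x + 1 / (j : ℝ))}

/-- min_{b ∈ β} ‖y - b‖², written as an infimum over the image set. -/
def minDist (β : Set Plane) (y : Plane) : ℝ :=
  sInf ((fun b => ‖y - b‖ ^ 2) '' β)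

/-- The distortion error ∫ min_{b ∈ β} ‖y - b‖² dP(y) of a set β. -/
def distortion (β : Set Plane) : ℝ := ∫ y, minDist β y ∂P

/-- The n-th constrained quantization error for P with respect to the family (S_j). -/
def Vn (n : ℕ) : ℝ :=
  sInf {v : ℝ | ∃ α : Finset Plane,
    ↑α ⊆ (⋃ j ∈ Finset.Icc 1 n, S j) ∧ 1 ≤ α.card ∧ α.card ≤ n ∧ v = distortion ↑α}

/-- α is an optimal set of n-points for P: α ⊆ ⋃_{j=1}^n S_j, 1 ≤ card α ≤ n, and α attains the
n-th constrained quantization error. -/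
def IsOptimalNPoints (n : ℕ) (α : Finset Plane) : Prop :=
  ↑α ⊆ (⋃ j ∈ Finset.Icc 1 n, S j) ∧ 1 ≤ α.card ∧ α.card ≤ n ∧ distortion ↑α = Vn n

/-- The squared distance from a point of the line containing `J` to a point of the plane,
split along the directions orthogonal and parallel to the lines containing the `S j`. -/
lemma norm_pt_sub_sq (t : ℝ) (a : Plane) :
    ‖pt t 0 - a‖ ^ 2 = ((t + (a 1 - a 0)) ^ 2 + (t - (a 0 + a 1)) ^ 2) / 2 := by
  rw [EuclideanSpace.norm_sq_eq]
  simp [pt, Fin.sum_univ_two]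
  ring

lemma continuous_pt_zero : Continuous fun t : ℝ => pt t 0 := by
  unfold pt
  refine (PiLp.continuous_toLp 2 _).comp (continuous_pi fun i => ?_)
  fin_cases i
  · exact continuous_id
  · exact continuous_const

lemma minDist_eq_inf' (α : Finset Plane) (hα : α.Nonempty) (y : Plane) :
    minDist ↑α y = α.inf' hα (fun b => ‖y - b‖ ^ 2) :=
  (Finset.inf'_eq_csInf_image α hα _).symm

lemma continuous_minDist (α : Finset Plane) (hα : α.Nonempty) :
    Continuous (minDist (↑α : Set Plane)) := by
  rw [funext (minDist_eq_inf' α hα)]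
  refine Continuous.finset_inf'_apply hα fun b _ => ?_
  fun_prop

lemma distortion_eq_intervalIntegral (α : Finset Plane) (hα : α.Nonempty) :
    distortion ↑α = ∫ t in (0 : ℝ)..1, minDist ↑α (pt t 0) := by
  rw [distortion, P, integral_map continuous_pt_zero.aemeasurable
    (continuous_minDist α hα).aestronglyMeasurable,
    intervalIntegral.integral_of_le zero_le_one, integral_Icc_eq_integral_Ioc]

lemma minDist_nonneg (β : Set Plane) (y : Plane) : 0 ≤ minDist β y := by
  refine Real.sInf_nonneg ?_
  rintro _ ⟨b, _, rfl⟩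
  positivity

lemma Vn_le_distortion {n : ℕ} {α : Finset Plane}
    (hα : ↑α ⊆ (⋃ j ∈ Finset.Icc 1 n, S j)) (h1 : 1 ≤ α.card) (hn : α.card ≤ n) :
    Vn n ≤ distortion ↑α := by
  refine csInf_le ⟨0, ?_⟩ ⟨α, hα, h1, hn, rfl⟩
  rintro _ ⟨β, _, _, _, rfl⟩
  exact integral_nonneg (minDist_nonneg _)

/-- If `β` serves every point of `J` at least as well as `α` does, and some point of `J` strictly
better, then `β` has smaller distortion. -/
lemma distortion_lt_of_dominates {α β : Finset Plane} (hα : α.Nonempty) (hβ : β.Nonempty)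
    (hle : ∀ t ∈ Set.Icc (0 : ℝ) 1, ∀ a ∈ α, ∃ b ∈ β, ‖pt t 0 - b‖ ^ 2 ≤ ‖pt t 0 - a‖ ^ 2)
    (hlt : ∃ t ∈ Set.Icc (0 : ℝ) 1, ∀ a ∈ α, ∃ b ∈ β, ‖pt t 0 - b‖ ^ 2 < ‖pt t 0 - a‖ ^ 2) :
    distortion ↑β < distortion ↑α := by
  rw [distortion_eq_intervalIntegral α hα, distortion_eq_intervalIntegral β hβ]
  refine intervalIntegral.integral_lt_integral_of_continuousOn_of_le_of_exists_lt zero_lt_one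
    ((continuous_minDist β hβ).comp continuous_pt_zero).continuousOn
    ((continuous_minDist α hα).comp continuous_pt_zero).continuousOn ?_ ?_
  · intro t ht
    rw [minDist_eq_inf' α hα, minDist_eq_inf' β hβ, Finset.le_inf'_iff]
    intro a ha
    obtain ⟨b, hb, hba⟩ := hle t ⟨ht.1.le, ht.2⟩ a ha
    exact (Finset.inf'_le _ hb).trans hba
  · obtain ⟨t, ht, hab⟩ := hlt
    refine ⟨t, ht, ?_⟩
    rw [minDist_eq_inf' α hα, minDist_eq_inf' β hβ, Finset.lt_inf'_iff]
    intro a ha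
    obtain ⟨b, hb, hba⟩ := hab a ha
    exact (Finset.inf'_le _ hb).trans_lt hba

/-- The point of the line containing `S n` whose orthogonal projection along that line's normal
hits the first axis at `(u, 0)`. -/
def footPt (n : ℕ) (u : ℝ) : Plane := pt ((u - 1 / n) / 2) ((u + 1 / n) / 2)

lemma norm_pt_sub_footPt_sq (n : ℕ) (t u : ℝ) :
    ‖pt t 0 - footPt n u‖ ^ 2 = ((t + 1 / n) ^ 2 + (t - u) ^ 2) / 2 := by
  rw [norm_pt_sub_sq]
  simp [footPt, pt]
  ring

lemma footPt_mem_S {n : ℕ} {u : ℝ} (hu : u ∈ Set.Icc (0 : ℝ) 1) : footPt n u ∈ S n := by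
  have h : (0 : ℝ) ≤ 1 / n := by positivity
  refine ⟨(u - 1 / n) / 2, by linarith [hu.1], by linarith [hu.2], ?_⟩
  rw [footPt]
  congr 1
  ring

/-- The coordinate along the diagonal of a point of the plane, clamped to `[0, 1]`. -/
def clampCoord (a : Plane) : ℝ := max 0 (min 1 (a 0 + a 1))

lemma clampCoord_mem (a : Plane) : clampCoord a ∈ Set.Icc (0 : ℝ) 1 :=
  ⟨le_max_left _ _, max_le zero_le_one (min_le_left _ _)⟩

lemma sub_clampCoord_sq_le {t : ℝ} (ht : t ∈ Set.Icc (0 : ℝ) 1) (a : Plane) :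
    (t - clampCoord a) ^ 2 ≤ (t - (a 0 + a 1)) ^ 2 := by
  obtain ⟨h0, h1⟩ := ht
  unfold clampCoord
  rcases le_total 1 (a 0 + a 1) with h | h
  · rw [min_eq_left h, max_eq_right zero_le_one]
    nlinarith
  · rw [min_eq_right h]
    rcases le_total 0 (a 0 + a 1) with h' | h'
    · rw [max_eq_right h']
    · rw [max_eq_left h']
      nlinarith

lemma sub_clampCoord_sq_lt {t : ℝ} (ht : t ∈ Set.Icc (0 : ℝ) 1) {a : Plane}
    (ha : a 0 + a 1 ∉ Set.Icc (0 : ℝ) 1) :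
    (t - clampCoord a) ^ 2 < (t - (a 0 + a 1)) ^ 2 := by
  obtain ⟨h0, h1⟩ := ht
  unfold clampCoord
  rcases lt_or_ge 1 (a 0 + a 1) with h | h
  · rw [min_eq_left h.le, max_eq_right zero_le_one]
    nlinarith
  · rw [min_eq_right h]
    rcases le_or_gt 0 (a 0 + a 1) with h' | h'
    · exact absurd ⟨h', h⟩ ha
    · rw [max_eq_left h'.le]
      nlinarith

lemma norm_pt_sub_footPt_clampCoord_le {n : ℕ} {t : ℝ} (ht : t ∈ Set.Icc (0 : ℝ) 1) {a : Plane}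
    (ha : 1 / (n : ℝ) ≤ a 1 - a 0) :
    ‖pt t 0 - footPt n (clampCoord a)‖ ^ 2 ≤ ‖pt t 0 - a‖ ^ 2 := by
  rw [norm_pt_sub_footPt_sq, norm_pt_sub_sq]
  have h : (0 : ℝ) ≤ 1 / n := by positivity
  have := sub_clampCoord_sq_le ht a
  have : (t + 1 / (n : ℝ)) ^ 2 ≤ (t + (a 1 - a 0)) ^ 2 :=
    pow_le_pow_left₀ (by linarith [ht.1]) (by linarith) 2
  linarith

lemma norm_pt_sub_footPt_clampCoord_lt {n : ℕ} {t : ℝ} (ht : t ∈ Set.Icc (0 : ℝ) 1) {a : Plane}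
    (ha : 1 / (n : ℝ) ≤ a 1 - a 0)
    (hbad : ¬ (a 1 - a 0 = 1 / n ∧ a 0 + a 1 ∈ Set.Icc (0 : ℝ) 1)) :
    ‖pt t 0 - footPt n (clampCoord a)‖ ^ 2 < ‖pt t 0 - a‖ ^ 2 := by
  rw [norm_pt_sub_footPt_sq, norm_pt_sub_sq]
  have h : (0 : ℝ) ≤ 1 / n := by positivity
  rcases ha.lt_or_eq with hc | hc
  · have := sub_clampCoord_sq_le ht a
    have : (t + 1 / (n : ℝ)) ^ 2 < (t + (a 1 - a 0)) ^ 2 :=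
      pow_lt_pow_left₀ (by linarith) (by linarith [ht.1]) two_ne_zero
    linarith
  · have := sub_clampCoord_sq_lt ht fun hu => hbad ⟨hc.symm, hu⟩
    rw [← hc]
    linarith

lemma one_div_le_of_mem_iUnion_S {n : ℕ} {a : Plane} (ha : a ∈ ⋃ j ∈ Finset.Icc 1 n, S j) :
    1 / (n : ℝ) ≤ a 1 - a 0 := by
  simp only [Set.mem_iUnion, Finset.mem_Icc] at ha
  obtain ⟨j, ⟨hj1, hjn⟩, x, -, -, rfl⟩ := ha
  have : 1 / (n : ℝ) ≤ 1 / j :=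
    one_div_le_one_div_of_le (by exact_mod_cast hj1) (by exact_mod_cast hjn)
  simpa [pt] using this

open Classical in
/-- If some element `p` of `α` lies off `S n` or is the nearest point of that line to no point of
`J`, then some admissible set of at most `n` points has smaller distortion. -/
lemma exists_distortion_lt {n : ℕ} (hn : 1 ≤ n) {α : Finset Plane}
    (hα : ↑α ⊆ (⋃ j ∈ Finset.Icc 1 n, S j)) (hcard : α.card ≤ n) {p : Plane} (hp : p ∈ α)
    (hbad : ¬ (p 1 - p 0 = 1 / n ∧ p 0 + p 1 ∈ Set.Icc (0 : ℝ) 1)) :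
    ∃ β : Finset Plane, ↑β ⊆ (⋃ j ∈ Finset.Icc 1 n, S j) ∧ 1 ≤ β.card ∧ β.card ≤ n ∧
      distortion ↑β < distortion ↑α := by
  have hc : ∀ a ∈ α, 1 / (n : ℝ) ≤ a 1 - a 0 := fun a ha => one_div_le_of_mem_iUnion_S (hα ha)
  set U : Finset ℝ := (α.erase p).image clampCoord
  have hUmem : ∀ a ∈ α, a ≠ p → clampCoord a ∈ U := fun a ha hap =>
    Finset.mem_image_of_mem _ (Finset.mem_erase.2 ⟨hap, ha⟩)
  have hUIcc : ∀ u ∈ U, u ∈ Set.Icc (0 : ℝ) 1 := by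
    intro u hu
    obtain ⟨a, -, rfl⟩ := Finset.mem_image.1 hu
    exact clampCoord_mem a
  suffices ∃ v ∈ Set.Icc (0 : ℝ) 1,
      (∀ t ∈ Set.Icc (0 : ℝ) 1, ∀ a ∈ α, ∃ u ∈ insert v U,
        ‖pt t 0 - footPt n u‖ ^ 2 ≤ ‖pt t 0 - a‖ ^ 2) ∧
      ∃ t ∈ Set.Icc (0 : ℝ) 1, ∀ a ∈ α,
        ‖pt t 0 - footPt n v‖ ^ 2 < ‖pt t 0 - a‖ ^ 2 by
    obtain ⟨v, hv, hle, t, ht, hlt⟩ := this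
    have hne : ((insert v U).image (footPt n)).Nonempty := (Finset.insert_nonempty _ _).image _
    refine ⟨(insert v U).image (footPt n), ?_, hne.card_pos, ?_, ?_⟩
    · intro b hb
      obtain ⟨u, hu, rfl⟩ := Finset.mem_image.1 (Finset.mem_coe.1 hb)
      have huI : u ∈ Set.Icc (0 : ℝ) 1 := by
        rcases Finset.mem_insert.1 hu with rfl | hu
        · exact hv
        · exact hUIcc u hu
      exact Set.mem_biUnion (Finset.mem_coe.2 (Finset.mem_Icc.2 ⟨hn, le_rfl⟩)) (footPt_mem_S huI)
    · have h1 : U.card ≤ (α.erase p).card := Finset.card_image_le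
      have h2 := Finset.card_erase_add_one hp
      have h3 : ((insert v U).image (footPt n)).card ≤ (insert v U).card := Finset.card_image_le
      have h4 := Finset.card_insert_le v U
      omega
    · refine distortion_lt_of_dominates ⟨p, hp⟩ hne ?_ ⟨t, ht, fun a ha =>
        ⟨_, Finset.mem_image_of_mem _ (Finset.mem_insert_self v U), hlt a ha⟩⟩
      intro t ht a ha
      obtain ⟨u, hu, hua⟩ := hle t ht a ha
      exact ⟨_, Finset.mem_image_of_mem _ hu, hua⟩
  by_cases hcase : ∃ t ∈ Set.Icc (0 : ℝ) 1, ∀ u ∈ U,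
      ‖pt t 0 - footPt n (clampCoord p)‖ ^ 2 < ‖pt t 0 - footPt n u‖ ^ 2
  · obtain ⟨t, ht, htU⟩ := hcase
    refine ⟨clampCoord p, clampCoord_mem p, fun s hs a ha => ⟨clampCoord a, ?_,
      norm_pt_sub_footPt_clampCoord_le hs (hc a ha)⟩, t, ht, fun a ha => ?_⟩
    · by_cases hap : a = p
      · rw [hap]
        exact Finset.mem_insert_self _ _
      · exact Finset.mem_insert_of_mem (hUmem a ha hap)
    · by_cases hap : a = p
      · rw [hap]
        exact norm_pt_sub_footPt_clampCoord_lt ht (hc p hp) hbad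
      · exact (htU _ (hUmem a ha hap)).trans_le (norm_pt_sub_footPt_clampCoord_le ht (hc a ha))
  · push Not at hcase
    obtain ⟨v, hv, hvU⟩ := (Set.Icc_infinite (zero_lt_one' ℝ)).exists_notMem_finset U
    refine ⟨v, hv, fun s hs a ha => ?_, v, hv, fun a ha => ?_⟩
    · by_cases hap : a = p
      · obtain ⟨u, hu, hup⟩ := hcase s hs
        rw [hap]
        exact ⟨u, Finset.mem_insert_of_mem hu,
          hup.trans (norm_pt_sub_footPt_clampCoord_le hs (hc p hp))⟩
      · exact ⟨_, Finset.mem_insert_of_mem (hUmem a ha hap),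
          norm_pt_sub_footPt_clampCoord_le hs (hc a ha)⟩
    · by_cases hap : a = p
      · rw [hap]
        refine lt_of_le_of_lt ?_ (norm_pt_sub_footPt_clampCoord_lt hv (hc p hp) hbad)
        rw [norm_pt_sub_footPt_sq, norm_pt_sub_footPt_sq, sub_self]
        linarith [sq_nonneg (v - clampCoord p)]
      · refine lt_of_lt_of_le ?_ (norm_pt_sub_footPt_clampCoord_le hv (hc a ha))
        rw [norm_pt_sub_footPt_sq, norm_pt_sub_footPt_sq, sub_self]
        have hne : v - clampCoord a ≠ 0 :=
          sub_ne_zero.2 fun h => hvU (h ▸ hUmem a ha hap)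
        have := pow_pos (abs_pos.2 hne) 2
        rw [sq_abs] at this
        linarith

/-- every element of an optimal set of n-points lies on S_n between
(−1/(2n), 1/(2n)) and ((n−1)/(2n), (n+1)/(2n)); in particular its first coordinate a
satisfies −1/(2n) ≤ a ≤ (n−1)/(2n). -/
theorem optimal_points_location (n : ℕ) (hn : 1 ≤ n) (α : Finset Plane)
    (h : IsOptimalNPoints n α) :
    ∀ p ∈ α, ∃ x : ℝ, -(1 / (2 * (n : ℝ))) ≤ x ∧ x ≤ ((n : ℝ) - 1) / (2 * n) ∧
      p = pt x (x + 1 / n) := by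
  obtain ⟨hα, h1, hcard, hopt⟩ := h
  intro p hp
  by_cases hgood : p 1 - p 0 = 1 / n ∧ p 0 + p 1 ∈ Set.Icc (0 : ℝ) 1
  · obtain ⟨hc, hu0, hu1⟩ := hgood
    have hn0 : (n : ℝ) ≠ 0 := by positivity
    have e1 : 1 / (2 * (n : ℝ)) = 1 / n / 2 := by field_simp
    have e2 : ((n : ℝ) - 1) / (2 * n) = (1 - 1 / n) / 2 := by field_simp
    refine ⟨p 0, by rw [e1]; linarith, by rw [e2]; linarith, ?_⟩
    rw [← hc]
    ext i
    fin_cases i <;> simp [pt]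
  · obtain ⟨β, hβ, hβ1, hβn, hlt⟩ := exists_distortion_lt hn hα hcard hp hgood
    exact absurd (hopt ▸ Vn_le_distortion hβ hβ1 hβn) hlt.not_ge

end
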